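/- arXiv:2003.04825 — 3 statements merged into one kernel-verified Lean document; each statement's English description precedes it below -/
import Mathlib

section
/- Let V be a finite-dimensional vector space over a field k, φ : V → V linear, and σ ∈ S_n. Let σ act on V^{⊗n} by permuting tensor factors (without signs): σ·(v_1 ⊗ ... ⊗ v_n) = v_{σ^{-1}(1)} ⊗ ... ⊗ v_{σ^{-1}(n)}. Then Tr(σ ∘ φ^{⊗n}) = Π_{r=1}^{n} Tr(φ^r)^{m_r(σ)}, where m_r(σ) is the number of r-cycles of σ. -/
def cycleCount {n : ℕ} (g : Equiv.Perm (Fin n)) (r : ℕ) : ℕ :=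
  if r = 1 then (Finset.univ.filter fun i => g i = i).card
  else Multiset.count r g.cycleType

open Equiv in
/-- A permutation preserving a predicate has as cycle partition the sum of the cycle partitions of
its two restrictions. -/
theorem Equiv.Perm.parts_partition_subtypePerm_add {ι : Type*} [Fintype ι] [DecidableEq ι]
    (σ : Perm ι) (p : ι → Prop) [DecidablePred p] (hp : ∀ x, p (σ x) ↔ p x) :
    σ.partition.parts = (σ.subtypePerm hp).partition.parts +
      (σ.subtypePerm (p := fun x => ¬ p x) fun x => not_congr (hp x)).partition.parts := by
  set a := σ.subtypePerm hp with ha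
  set b := σ.subtypePerm (p := fun x => ¬ p x) fun x => not_congr (hp x) with hb
  have hmul : σ = Perm.ofSubtype a * Perm.ofSubtype b := by
    ext x
    by_cases hx : p x
    · rw [Perm.mul_apply, Perm.ofSubtype_apply_of_not_mem b (not_not.2 hx),
        Perm.ofSubtype_apply_of_mem a hx, ha, Perm.subtypePerm_apply]
    · rw [Perm.mul_apply, Perm.ofSubtype_apply_of_mem b hx, hb, Perm.subtypePerm_apply,
        Perm.ofSubtype_apply_of_not_mem a (mt (hp x).1 hx)]
  have hdisj : Perm.Disjoint (Perm.ofSubtype a) (Perm.ofSubtype b) := by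
    intro x
    by_cases hx : p x
    · exact Or.inr (Perm.ofSubtype_apply_of_not_mem b (not_not.2 hx))
    · exact Or.inl (Perm.ofSubtype_apply_of_not_mem a hx)
  have htype : σ.cycleType = a.cycleType + b.cycleType := by
    rw [hmul, hdisj.cycleType_mul, Perm.cycleType_ofSubtype, Perm.cycleType_ofSubtype]
  have hsupp : σ.support.card = a.support.card + b.support.card := by
    rw [← Perm.sum_cycleType, htype, Multiset.sum_add, Perm.sum_cycleType, Perm.sum_cycleType]
  have hcard : Fintype.card ι = Fintype.card {x // p x} + Fintype.card {x // ¬ p x} := by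
    rw [← Fintype.card_sum]
    exact Fintype.card_congr (Equiv.sumCompl p).symm
  have h1 := a.support.card_le_univ
  have h2 := b.support.card_le_univ
  rw [Perm.parts_partition, Perm.parts_partition, Perm.parts_partition, htype, hsupp, hcard,
    tsub_add_tsub_comm h1 h2 |>.symm, Multiset.replicate_add]
  abel

open Equiv in
theorem Equiv.Perm.IsCycleOn.parts_partition {ι : Type*} [Fintype ι] [DecidableEq ι] [Nonempty ι]
    {σ : Perm ι} (hσ : σ.IsCycleOn _root_.Set.univ) : σ.partition.parts = {Fintype.card ι} := by
  rcases subsingleton_or_nontrivial ι with hι | hι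
  · obtain rfl : σ = 1 := Subsingleton.elim _ _
    have : Fintype.card ι = 1 :=
      le_antisymm (Fintype.card_le_one_iff_subsingleton.2 hι) Fintype.card_pos
    simp [Perm.parts_partition, this]
  · have hc : σ.IsCycle := Perm.isCycle_iff_exists_isCycleOn.2
      ⟨_root_.Set.univ, Set.nontrivial_univ, hσ, fun _ _ => Set.mem_univ _⟩
    have hs : σ.support = Finset.univ := Finset.eq_univ_of_forall fun x =>
      Perm.mem_support.2 (hσ.apply_ne Set.nontrivial_univ (Set.mem_univ x))
    simp [Perm.parts_partition, hc.cycleType, hs]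

namespace Matrix

variable {R κ : Type*} [CommSemiring R] [Fintype κ]

/-- The trace of `A ^ r * B` as a sum over walks. -/
theorem sum_prod_mul_eq_trace_pow_mul [DecidableEq κ] (A B : Matrix κ κ R) (r : ℕ) :
    ∑ p : Fin (r + 1) → κ, (∏ i : Fin r, A (p i.succ) (p i.castSucc)) * B (p 0) (p (Fin.last r)) =
      (A ^ r * B).trace := by
  induction r generalizing B with
  | zero =>
    rw [← (Equiv.funUnique (Fin 1) κ).symm.sum_comp]
    simp [Matrix.trace]
  | succ r ih =>
    rw [pow_succ', mul_assoc, Matrix.trace_mul_comm, mul_assoc, ← ih,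
      ← (Fin.snocEquiv fun _ : Fin (r + 2) => κ).sum_comp, Fintype.sum_prod_type_right]
    refine Finset.sum_congr rfl fun p _ => ?_
    simp only [Fin.snocEquiv_apply, Fin.prod_univ_castSucc, Fin.succ_last, Fin.succ_castSucc,
      Fin.snoc_castSucc, Fin.snoc_last, Matrix.mul_apply, Finset.mul_sum]
    refine Finset.sum_congr rfl fun c _ => ?_
    rw [← Fin.castSucc_zero, Fin.snoc_castSucc]
    ring

/-- The trace of a power as a sum over closed walks. -/
theorem sum_prod_finRotate_eq_trace_pow [DecidableEq κ] (A : Matrix κ κ R) (r : ℕ) :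
    ∑ p : Fin (r + 1) → κ, ∏ i, A (p (finRotate (r + 1) i)) (p i) = (A ^ (r + 1)).trace := by
  rw [pow_succ, ← sum_prod_mul_eq_trace_pow_mul]
  refine Finset.sum_congr rfl fun p _ => ?_
  rw [Fin.prod_univ_castSucc]
  simp

open Equiv in
theorem sum_prod_perm_eq_trace_pow_of_isCycleOn [DecidableEq κ] {ι : Type*} [Fintype ι]
    [DecidableEq ι] [Nonempty ι] (A : Matrix κ κ R) {σ : Perm ι} (hσ : σ.IsCycleOn Set.univ) :
    ∑ p : ι → κ, ∏ i, A (p (σ i)) (p i) = (A ^ Fintype.card ι).trace := by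
  obtain ⟨x⟩ := ‹Nonempty ι›
  obtain ⟨r, hr⟩ := Nat.exists_eq_succ_of_ne_zero (Fintype.card_ne_zero (α := ι))
  rw [← Finset.coe_univ] at hσ
  have hpow : (σ ^ (r + 1)) x = x := by
    have := hσ.pow_card_apply (Finset.mem_univ x)
    rwa [Finset.card_univ, hr] at this
  have hbij : Function.Bijective fun i : Fin (r + 1) => (σ ^ (i : ℕ)) x := by
    refine (Fintype.bijective_iff_surjective_and_card _).2 ⟨fun y => ?_, by simp [hr]⟩
    obtain ⟨m, hm, rfl⟩ := hσ.exists_pow_eq (Finset.mem_univ x) (Finset.mem_univ y)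
    rw [Finset.card_univ, hr] at hm
    exact ⟨⟨m, hm⟩, rfl⟩
  let e : Fin (r + 1) ≃ ι := Equiv.ofBijective _ hbij
  have he : ∀ i, e (finRotate (r + 1) i) = σ (e i) := by
    intro i
    change (σ ^ (finRotate (r + 1) i : ℕ)) x = σ ((σ ^ (i : ℕ)) x)
    rw [← Perm.mul_apply, ← pow_succ']
    induction i using Fin.lastCases with
    | last => simp [hpow]
    | cast i => simp
  rw [hr, Nat.succ_eq_add_one, ← sum_prod_finRotate_eq_trace_pow,
    ← (Equiv.arrowCongr e (Equiv.refl κ)).sum_comp]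
  refine Finset.sum_congr rfl fun p _ => ?_
  rw [← e.prod_comp]
  simp [← he]

open Equiv in
theorem sum_prod_perm_eq_mul {ι : Type*} [Fintype ι] [DecidableEq ι] (A : Matrix κ κ R)
    (σ : Perm ι) (q : ι → Prop) [DecidablePred q] (hq : ∀ x, q (σ x) ↔ q x) :
    ∑ p : ι → κ, ∏ i, A (p (σ i)) (p i) =
      (∑ p : {x // q x} → κ, ∏ i, A (p (σ.subtypePerm hq i)) (p i)) *
      ∑ p : {x // ¬ q x} → κ,
        ∏ i, A (p (σ.subtypePerm (p := fun x => ¬ q x) (fun x => not_congr (hq x)) i)) (p i) := by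
  rw [Finset.sum_mul_sum, ← Fintype.sum_prod_type',
    ← (Equiv.piEquivPiSubtypeProd q fun _ => κ).sum_comp]
  refine Finset.sum_congr rfl fun p _ => ?_
  exact (Fintype.prod_subtype_mul_prod_subtype q fun i => A (p (σ i)) (p i)).symm

open Equiv in
theorem sum_prod_perm_eq_prod_trace_pow [DecidableEq κ] {ι : Type*} [Fintype ι]
    [DecidableEq ι] (A : Matrix κ κ R) (σ : Perm ι) :
    ∑ p : ι → κ, ∏ i, A (p (σ i)) (p i) =
      (σ.partition.parts.map fun r => (A ^ r).trace).prod := by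
  obtain ⟨n, hn⟩ : ∃ n, Fintype.card ι = n := ⟨_, rfl⟩
  induction n using Nat.strong_induction_on generalizing ι with
  | _ n ih =>
    subst hn
    rcases isEmpty_or_nonempty ι with hι | ⟨⟨x⟩⟩
    · obtain rfl : σ = 1 := Subsingleton.elim _ _
      simp [Perm.parts_partition]
    have hq : ∀ y, σ.SameCycle x (σ y) ↔ σ.SameCycle x y := fun y => Perm.sameCycle_apply_right
    have : Nonempty {y // σ.SameCycle x y} := ⟨⟨x, Perm.SameCycle.refl _ _⟩⟩
    have hcyc : (σ.subtypePerm hq).IsCycleOn Set.univ := by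
      refine ⟨(σ.subtypePerm hq).bijective.bijOn_univ, fun y _ z _ => ?_⟩
      exact Perm.sameCycle_subtypePerm.2 (y.2.symm.trans z.2)
    rw [sum_prod_perm_eq_mul A σ _ hq, σ.parts_partition_subtypePerm_add _ hq,
      Multiset.map_add, Multiset.prod_add, hcyc.parts_partition,
      sum_prod_perm_eq_trace_pow_of_isCycleOn A hcyc,
      ih _ (Fintype.card_subtype_lt (x := x) (not_not.2 (Perm.SameCycle.refl _ _))) _ rfl]
    simp

end Matrix

theorem count_parts_partition_eq_cycleCount {n : ℕ} (σ : Equiv.Perm (Fin n)) {r : ℕ}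
    (hr : r ≠ 0) : σ.partition.parts.count r = cycleCount σ r := by
  rw [Equiv.Perm.parts_partition, Multiset.count_add, Multiset.count_replicate, cycleCount]
  split_ifs with h1 h2 h2
  · subst h1
    have h0 : Multiset.count 1 σ.cycleType = 0 := Multiset.count_eq_zero.2 fun h =>
      (Equiv.Perm.one_lt_of_mem_cycleType h).ne rfl
    rw [h0, zero_add, ← Finset.card_compl]
    congr 1
    ext i
    simp
  · exact absurd h1.symm h2
  · exact absurd h2.symm h1
  · rfl

/-- For `σ ∈ S_n` acting on `V^{⊗n}` by permuting tensor factors (no signs) and a linear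
endomorphism `φ` of a finite-dimensional `V`,
`Tr(σ ∘ φ^{⊗n}) = Π_{r=1}^n Tr(φ^r)^{m_r(σ)}`. -/
theorem stmt_6 {k : Type*} [Field k] {V : Type*} [AddCommGroup V] [Module k V]
    [FiniteDimensional k V] {n : ℕ} (φ : V →ₗ[k] V) (σ : Equiv.Perm (Fin n)) :
    LinearMap.trace k (PiTensorProduct k fun _ : Fin n => V)
        ((PiTensorProduct.reindex k (fun _ : Fin n => V) σ).toLinearMap ∘ₗ
          PiTensorProduct.map fun _ => φ) =
      ∏ r ∈ Finset.range n, LinearMap.trace k V (φ ^ (r + 1)) ^ cycleCount σ (r + 1) := by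
  let b := Module.finBasis k V
  let A := LinearMap.toMatrix b b φ
  have htr (r : ℕ) : LinearMap.trace k V (φ ^ r) = (A ^ r).trace := by
    rw [LinearMap.trace_eq_matrix_trace k b, LinearMap.toMatrix_pow]
  have hlhs : LinearMap.trace k (PiTensorProduct k fun _ : Fin n => V)
        ((PiTensorProduct.reindex k (fun _ : Fin n => V) σ).toLinearMap ∘ₗ
          PiTensorProduct.map fun _ => φ) =
      ∑ p : Fin n → Fin (Module.finrank k V), ∏ i, A (p (σ i)) (p i) := by
    rw [LinearMap.trace_eq_matrix_trace k (Basis.piTensorProduct fun _ : Fin n => b),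
      Matrix.trace]
    refine Finset.sum_congr rfl fun p _ => ?_
    rw [Matrix.diag_apply, LinearMap.toMatrix_apply, Basis.piTensorProduct_apply,
      LinearMap.comp_apply, PiTensorProduct.map_tprod, LinearEquiv.coe_coe,
      PiTensorProduct.reindex_tprod, Basis.piTensorProduct_repr_tprod_apply,
      ← Equiv.prod_comp σ]
    simp [A, LinearMap.toMatrix_apply]
  have hmem : σ.partition.parts.toFinset ⊆ (Finset.range n).image (· + 1) := by
    intro r hr
    rw [Multiset.mem_toFinset] at hr
    have hpos := σ.partition.parts_pos hr
    have hle := Multiset.le_sum_of_mem hr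
    rw [σ.partition.parts_sum, Fintype.card_fin] at hle
    exact Finset.mem_image.2 ⟨r - 1, Finset.mem_range.2 (by omega), by omega⟩
  rw [hlhs, Matrix.sum_prod_perm_eq_prod_trace_pow, Finset.prod_multiset_map_count,
    Finset.prod_subset hmem, Finset.prod_image (by simp)]
  · refine Finset.prod_congr rfl fun r _ => ?_
    rw [htr, count_parts_partition_eq_cycleCount σ r.succ_ne_zero]
  · intro r _ hr
    rw [Multiset.mem_toFinset] at hr
    rw [Multiset.count_eq_zero.2 hr, pow_zero]
end

section
/- Let V be a finite-dimensional vector space over a field k of characteristic zero, φ : V → V linear, and G ≤ S_n acting on V^{⊗n} by permuting tensor factors. Then the trace of φ^{⊗n} restricted to the subspace of G-invariants (V^{⊗n})^G equals Z_G(Tr(φ), Tr(φ^2), ..., Tr(φ^n)), where Z_G is the cycle index of G. -/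
/-- The subspace of `G`-invariants of `V^{⊗n}` for the (unsigned) permutation action of
`G ≤ S_n` on tensor factors. -/
noncomputable def tensorInv (k : Type*) [Field k] (V : Type*) [AddCommGroup V] [Module k V]
    {n : ℕ} (G : Subgroup (Equiv.Perm (Fin n))) :
    Submodule k (PiTensorProduct k fun _ : Fin n => V) :=
  ⨅ g : G, LinearMap.ker
    ((PiTensorProduct.reindex k (fun _ : Fin n => V) (g : Equiv.Perm (Fin n))).toLinearMap -
      LinearMap.id)

open Finset

section PermTrace

variable {R ι : Type*} [CommRing R] [Fintype ι]

/-- The trace of `A^{⊗α}` composed with the permutation `σ` of the tensor factors, as a sum over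
basis tensors. -/
def permTrace {α : Type*} [Fintype α] [DecidableEq α] (A : Matrix ι ι R) (σ : Equiv.Perm α) : R :=
  ∑ f : α → ι, ∏ a, A (f (σ a)) (f a)

theorem sum_prod_path_mul [DecidableEq ι] (A : Matrix ι ι R) (m : ℕ) (B : Matrix ι ι R) :
    ∑ f : Fin (m + 1) → ι, (∏ i : Fin m, A (f i.succ) (f i.castSucc)) * B (f 0) (f (Fin.last m)) =
      (B * A ^ m).trace := by
  induction m generalizing B with
  | zero =>
    rw [← (Equiv.funUnique (Fin 1) ι).symm.sum_comp]
    simp [Matrix.trace]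
  | succ m ih =>
    rw [← (Fin.consEquiv fun _ : Fin (m + 2) => ι).sum_comp, Fintype.sum_prod_type_right,
      pow_succ, ← mul_assoc, Matrix.trace_mul_comm, ← mul_assoc, ← ih]
    refine sum_congr rfl fun f _ => ?_
    rw [Matrix.mul_apply, mul_sum]
    refine sum_congr rfl fun x _ => ?_
    rw [Fin.prod_univ_succ]
    simp only [Fin.consEquiv_apply, Fin.cons_succ, Fin.castSucc_zero, Fin.cons_zero,
      ← Fin.succ_castSucc, ← Fin.succ_last]
    ring

theorem permTrace_finRotate [DecidableEq ι] (A : Matrix ι ι R) (m : ℕ) :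
    permTrace A (finRotate (m + 1)) = (A ^ (m + 1)).trace := by
  rw [pow_succ', ← sum_prod_path_mul]
  refine sum_congr rfl fun f _ => ?_
  rw [Fin.prod_univ_castSucc]
  simp

variable {α : Type*} [Fintype α] [DecidableEq α]

theorem permTrace_congr {β : Type*} [Fintype β] [DecidableEq β] (A : Matrix ι ι R) (e : α ≃ β)
    {σ : Equiv.Perm α} {τ : Equiv.Perm β} (h : ∀ a, e (σ a) = τ (e a)) :
    permTrace A σ = permTrace A τ := by
  unfold permTrace
  rw [← (e.arrowCongr (Equiv.refl ι)).symm.sum_comp]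
  refine sum_congr rfl fun f _ => ?_
  rw [← e.prod_comp]
  simp [h]

theorem permTrace_one (A : Matrix ι ι R) :
    permTrace A (1 : Equiv.Perm α) = A.trace ^ Fintype.card α := by
  simpa [permTrace, Matrix.trace] using (Fintype.prod_sum fun (_ : α) i => A i i).symm

theorem permTrace_of_isCycleOn [DecidableEq ι] [Nonempty α] (A : Matrix ι ι R) {σ : Equiv.Perm α}
    (h : σ.IsCycleOn Set.univ) : permTrace A σ = (A ^ Fintype.card α).trace := by
  obtain ⟨x⟩ := ‹Nonempty α›
  obtain ⟨m, hm⟩ : ∃ m, Fintype.card α = m + 1 :=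
    Nat.exists_eq_succ_of_ne_zero (Fintype.card_pos_iff.2 ⟨x⟩).ne'
  have h' : σ.IsCycleOn ((univ : Finset α) : Set α) := by simpa using h
  have hinj : Function.Injective fun i : Fin (m + 1) => (σ ^ (i : ℕ)) x := by
    intro i j hij
    have := (h'.pow_apply_eq_pow_apply (mem_univ x)).1 hij
    rw [card_univ, hm] at this
    exact Fin.ext (Nat.ModEq.eq_of_lt_of_lt this i.2 j.2)
  have hbij := (Fintype.bijective_iff_injective_and_card _).2 ⟨hinj, by simp [hm]⟩
  rw [hm, ← permTrace_finRotate]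
  refine (permTrace_congr A (Equiv.ofBijective _ hbij) fun i => ?_).symm
  simp only [Equiv.ofBijective_apply]
  rw [← Equiv.Perm.mul_apply, ← pow_succ', h'.pow_apply_eq_pow_apply (mem_univ x), card_univ, hm]
  rcases Fin.eq_castSucc_or_eq_last i with ⟨j, rfl⟩ | rfl
  · simp [Nat.ModEq]
  · simp [Nat.ModEq]

theorem permTrace_eq_prod_fiber {κ : Type*} [Fintype κ] [DecidableEq κ] (A : Matrix ι ι R)
    (σ : Equiv.Perm α) (p : α → κ) (hp : ∀ a, p (σ a) = p a) :
    permTrace A σ =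
      ∏ c, permTrace A (σ.subtypePerm (p := fun a => p a = c) fun a => by rw [hp]) := by
  unfold permTrace
  rw [Fintype.prod_sum]
  let e : (α → ι) ≃ ((c : κ) → {a // p a = c} → ι) :=
    ((Equiv.sigmaFiberEquiv p).arrowCongr (Equiv.refl ι)).symm.trans
      (Equiv.piCurry fun _ _ => ι)
  rw [← e.sum_comp]
  refine sum_congr rfl fun f _ => ?_
  rw [← (Equiv.sigmaFiberEquiv p).prod_comp, Fintype.prod_sigma]
  rfl

theorem permTrace_eq_prod_cycleType [DecidableEq ι] (A : Matrix ι ι R) (σ : Equiv.Perm α) :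
    permTrace A σ = A.trace ^ #{a | σ a = a} * (σ.cycleType.map fun r => (A ^ r).trace).prod := by
  rw [permTrace_eq_prod_fiber A σ σ.cycleOf fun a =>
    Equiv.Perm.SameCycle.cycleOf_eq (Equiv.Perm.sameCycle_apply_left.2 (.refl _ _))]
  have hone : (1 : Equiv.Perm α) ∉ σ.cycleFactorsFinset := fun h =>
    (Equiv.Perm.mem_cycleFactorsFinset_iff.1 h).1.ne_one rfl
  rw [← prod_subset (subset_univ (insert 1 σ.cycleFactorsFinset)), prod_insert hone,
    Equiv.Perm.cycleType_def, Multiset.map_map]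
  · congr 1
    · have : σ.subtypePerm (p := fun a => σ.cycleOf a = 1) (fun a => by simp) = 1 := by
        ext ⟨a, ha⟩
        simpa [Equiv.Perm.cycleOf_eq_one_iff] using ha
      rw [this, permTrace_one, Fintype.card_subtype]
      simp only [Equiv.Perm.cycleOf_eq_one_iff]
    · refine prod_congr rfl fun c hc => ?_
      have hmem (a : α) : σ.cycleOf a = c ↔ a ∈ c.support := by
        rw [eq_comm, Equiv.Perm.eq_cycleOf_of_mem_cycleFactorsFinset_iff _ _ hc]
      obtain ⟨x, hx⟩ := (Equiv.Perm.mem_cycleFactorsFinset_iff.1 hc).1.nonempty_support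
      have : Nonempty {a // σ.cycleOf a = c} := ⟨⟨x, (hmem x).2 hx⟩⟩
      rw [permTrace_of_isCycleOn, Fintype.card_subtype]
      · simp only [hmem, filter_univ_mem, Function.comp_apply]
      · refine ⟨by simp [Set.bijOn_univ], ?_⟩
        rintro ⟨a, ha⟩ - ⟨b, hb⟩ -
        rw [Equiv.Perm.sameCycle_subtypePerm]
        have hs := Equiv.Perm.mem_cycleFactorsFinset_support_le hc
        exact (Equiv.Perm.sameCycle_iff_cycleOf_eq_of_mem_support (hs ((hmem a).1 ha))
          (hs ((hmem b).1 hb))).2 (ha.trans hb.symm)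
  · intro c _ hc
    have : IsEmpty {a // σ.cycleOf a = c} := by
      refine ⟨fun ⟨a, ha⟩ => hc ?_⟩
      rw [mem_insert, ← ha, Equiv.Perm.cycleOf_mem_cycleFactorsFinset_iff,
        Equiv.Perm.cycleOf_eq_one_iff, Equiv.Perm.mem_support]
      exact em _
    simp [permTrace]

theorem permTrace_eq_prod_cycleCount [DecidableEq ι] {n : ℕ} (A : Matrix ι ι R) (g : Equiv.Perm (Fin n)) :
    permTrace A g = ∏ r ∈ range n, (A ^ (r + 1)).trace ^ cycleCount g (r + 1) := by
  rw [permTrace_eq_prod_cycleType, prod_multiset_map_count]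
  cases n with
  | zero => simp [Subsingleton.elim g 1]
  | succ n =>
    rw [prod_range_succ']
    simp only [cycleCount, zero_add, if_true, pow_one, Nat.add_eq_right,
      Nat.succ_ne_zero, if_false]
    rw [mul_comm]
    congr 1
    refine Eq.trans ?_ (prod_map (range n) (addRightEmbedding 2)
      fun r => (A ^ r).trace ^ Multiset.count r g.cycleType)
    refine prod_subset (fun r hr => ?_) fun r _ hr => ?_
    · rw [Multiset.mem_toFinset] at hr
      have h2 := Equiv.Perm.two_le_of_mem_cycleType hr
      have hle : r ≤ n + 1 := by
        simpa using (Equiv.Perm.le_card_support_of_mem_cycleType hr).trans (card_le_univ _)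
      simp only [mem_map, mem_range, addRightEmbedding_apply]
      exact ⟨r - 2, by omega, by omega⟩
    · rw [Multiset.mem_toFinset] at hr
      simp [hr]

end PermTrace

section Trace

open PiTensorProduct

variable {k : Type*} [Field k] {V : Type*} [AddCommGroup V] [Module k V] {n : ℕ}

theorem trace_map_comp_reindex [FiniteDimensional k V] (φ : V →ₗ[k] V) (g : Equiv.Perm (Fin n)) :
    LinearMap.trace k _ ((PiTensorProduct.map fun _ : Fin n => φ) ∘ₗ
        (reindex k (fun _ : Fin n => V) g).toLinearMap) =
      ∏ r ∈ range n, LinearMap.trace k V (φ ^ (r + 1)) ^ cycleCount g (r + 1) := by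
  let b := Module.finBasis k V
  simp only [LinearMap.trace_eq_matrix_trace k b, ← LinearMap.toMatrix_pow]
  rw [← permTrace_eq_prod_cycleCount,
    LinearMap.trace_eq_matrix_trace k (Basis.piTensorProduct fun _ : Fin n => b)]
  refine sum_congr rfl fun f _ => ?_
  rw [Matrix.diag_apply, LinearMap.toMatrix_apply, Basis.piTensorProduct_apply,
    LinearMap.comp_apply, LinearEquiv.coe_coe, reindex_tprod, map_tprod,
    Basis.piTensorProduct_repr_tprod_apply, ← Equiv.prod_comp g]
  simp [LinearMap.toMatrix_apply]

theorem mem_tensorInv {G : Subgroup (Equiv.Perm (Fin n))}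
    {x : PiTensorProduct k fun _ : Fin n => V} :
    x ∈ tensorInv k V G ↔
      ∀ g : G, reindex k (fun _ : Fin n => V) (g : Equiv.Perm (Fin n)) x = x := by
  simp [tensorInv, sub_eq_zero]

theorem LinearMap.trace_restrict_eq_trace_comp {M : Type*} [AddCommGroup M] [Module k M]
    [FiniteDimensional k M] {W : Submodule k M} {f P : M →ₗ[k] M} (hf : ∀ x ∈ W, f x ∈ W)
    (hP : LinearMap.IsProj W P) : trace k W (f.restrict hf) = trace k M (f ∘ₗ P) := by
  have h1 : f.restrict hf = hP.codRestrict ∘ₗ (f ∘ₗ W.subtype) := by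
    ext x
    exact (hP.map_id _ (hf x x.2)).symm
  rw [h1, trace_comp_comm', comp_assoc, hP.subtype_comp_codRestrict]

variable (k V) in
/-- The average of the actions of the elements of `G` on `V^{⊗n}`. -/
noncomputable def tensorAverage (G : Subgroup (Equiv.Perm (Fin n))) :
    Module.End k (PiTensorProduct k fun _ : Fin n => V) :=
  (Nat.card G : k)⁻¹ •
    ∑ᶠ g : G, (reindex k (fun _ : Fin n => V) (g : Equiv.Perm (Fin n))).toLinearMap

theorem isProj_tensorAverage [CharZero k] (G : Subgroup (Equiv.Perm (Fin n))) :
    LinearMap.IsProj (tensorInv k V G) (tensorAverage k V G) := by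
  have := Fintype.ofFinite G
  constructor
  · intro x
    rw [mem_tensorInv]
    intro h
    simp only [tensorAverage, finsum_eq_sum_of_fintype, LinearMap.smul_apply, LinearMap.sum_apply,
      map_smul, map_sum, LinearEquiv.coe_coe]
    congr 1
    refine Fintype.sum_equiv (Equiv.mulLeft h) _ _ fun g => ?_
    exact reindex_reindex _ _ x
  · intro x hx
    rw [mem_tensorInv] at hx
    have hG : (Nat.card G : k) ≠ 0 := Nat.cast_ne_zero.2 Nat.card_pos.ne'
    simp only [tensorAverage, finsum_eq_sum_of_fintype, LinearMap.smul_apply, LinearMap.sum_apply,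
      LinearEquiv.coe_coe, hx, sum_const, card_univ, ← Nat.card_eq_fintype_card]
    rw [← Nat.cast_smul_eq_nsmul k, inv_smul_smul₀ hG]

end Trace

/-- The trace of `φ^{⊗n}` on the `G`-invariants of `V^{⊗n}` equals
`Z_G(Tr φ, Tr φ², …, Tr φⁿ)`, for `char k = 0`. -/
theorem stmt_7 {k : Type*} [Field k] [CharZero k] {V : Type*} [AddCommGroup V] [Module k V]
    [FiniteDimensional k V] {n : ℕ} (φ : V →ₗ[k] V) (G : Subgroup (Equiv.Perm (Fin n)))
    (hstab : ∀ x ∈ tensorInv k V G,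
      (PiTensorProduct.map fun _ : Fin n => φ) x ∈ tensorInv k V G) :
    LinearMap.trace k (tensorInv k V G)
        ((PiTensorProduct.map fun _ : Fin n => φ).restrict hstab) =
      (Nat.card G : k)⁻¹ *
        ∑ᶠ g : G, ∏ r ∈ Finset.range n,
          LinearMap.trace k V (φ ^ (r + 1)) ^ cycleCount (g : Equiv.Perm (Fin n)) (r + 1) := by
  have := Fintype.ofFinite G
  rw [LinearMap.trace_restrict_eq_trace_comp hstab (isProj_tensorAverage G), tensorAverage,
    LinearMap.comp_smul, map_smul, smul_eq_mul, finsum_eq_sum_of_fintype,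
    finsum_eq_sum_of_fintype, ← Module.End.mul_eq_comp, Finset.mul_sum, map_sum]
  simp only [Module.End.mul_eq_comp, trace_map_comp_reindex]
end

section
/- Let q be an odd prime power and n ≥ 2. Let Δ_n : F_q^n → F_q send (t_1,...,t_n) to the discriminant of the monic polynomial x^n + t_1 x^{n-1} + ... + t_n. Then the number of tuples whose discriminant is a nonzero quadratic residue equals the number of tuples whose discriminant is a quadratic non-residue. -/
open Polynomial

/-- The monic polynomial `x^n + t_1 x^{n-1} + ⋯ + t_n` with coefficient tuple `t`. -/
noncomputable def monicOf {F : Type*} [Field F] (n : ℕ) (t : Fin n → F) : Polynomial F :=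
  X ^ n + ∑ i : Fin n, C (t i) * X ^ (n - 1 - (i : ℕ))

/-- The discriminant `Δ_n(t_1,…,t_n)` of `x^n + t_1 x^{n-1} + ⋯ + t_n`, computed in an
algebraic closure via the formula `Δ(f) = (-1)^{n(n-1)/2} Π_α f'(α)` (product over the
roots `α` with multiplicity), which equals `Π_{i<j}(α_i - α_j)^2`. -/
noncomputable def discOf {F : Type*} [Field F] (n : ℕ) (t : Fin n → F) :
    AlgebraicClosure F :=
  (-1 : AlgebraicClosure F) ^ (n * (n - 1) / 2) *
    (((monicOf n t).map (algebraMap F (AlgebraicClosure F))).roots.map fun α =>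
      (Polynomial.derivative ((monicOf n t).map (algebraMap F (AlgebraicClosure F)))).eval α).prod

namespace Polynomial

section CommRing

variable {R S : Type*} [CommRing R] [CommRing S]

theorem Monic.resultant_eq_of_natDegree_le {f g : R[X]} (hf : f.Monic) {n : ℕ}
    (hn : g.natDegree ≤ n) : resultant f g f.natDegree n = resultant f g := by
  obtain ⟨k, rfl⟩ := Nat.exists_eq_add_of_le hn
  rw [resultant_add_right_deg _ _ _ _ _ le_rfl, hf.coeff_natDegree, one_pow, one_mul]

theorem Monic.resultant_mul_right {f : R[X]} (hf : f.Monic) (g h : R[X]) :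
    resultant f (g * h) = resultant f g * resultant f h := by
  rw [← Polynomial.resultant_mul_right f g h _ le_rfl,
    hf.resultant_eq_of_natDegree_le natDegree_mul_le]

theorem Monic.resultant_mul_left {f g : R[X]} (hf : f.Monic) (hg : g.Monic) (h : R[X]) :
    resultant (f * g) h = resultant f h * resultant g h := by
  rw [← Polynomial.resultant_mul_left f g h _ le_rfl, hf.natDegree_mul hg]

theorem Monic.resultant_add_mul_right {f : R[X]} (hf : f.Monic) (g p : R[X]) :
    resultant f (g + f * p) = resultant f g := by
  have h₁ : (g + f * p).natDegree ≤ g.natDegree + (p.natDegree + f.natDegree) :=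
    (natDegree_add_le _ _).trans <| max_le (by lia) (natDegree_mul_le.trans (by lia))
  rw [← hf.resultant_eq_of_natDegree_le h₁,
    Polynomial.resultant_add_mul_right _ _ _ _ _ (by lia) le_rfl,
    hf.resultant_eq_of_natDegree_le (by lia)]

theorem Monic.resultant_derivative {f : R[X]} (hf : f.Monic) :
    resultant f (derivative f) = (-1) ^ (f.natDegree * (f.natDegree - 1) / 2) * f.discr := by
  nontriviality R
  rcases Nat.eq_zero_or_pos f.natDegree with h | h
  · obtain rfl := hf.natDegree_eq_zero.mp h
    simpa using (discr_C (1 : R)).symm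
  · rw [← hf.resultant_eq_of_natDegree_le (natDegree_derivative_le f),
      resultant_deriv (natDegree_pos_iff_degree_pos.mp h), hf.leadingCoeff, mul_one]

theorem Monic.discr_eq {f : R[X]} (hf : f.Monic) :
    f.discr = (-1) ^ (f.natDegree * (f.natDegree - 1) / 2) * resultant f (derivative f) := by
  rw [hf.resultant_derivative, ← mul_assoc, ← mul_pow, neg_one_mul, neg_neg, one_pow, one_mul]

theorem Monic.discr_map {f : R[X]} (hf : f.Monic) (φ : R →+* S) :
    (f.map φ).discr = φ f.discr := by
  nontriviality S
  have h : resultant (f.map φ) (derivative f |>.map φ) = φ (resultant f (derivative f)) := by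
    rw [← (hf.map φ).resultant_eq_of_natDegree_le natDegree_map_le, hf.natDegree_map,
      resultant_map_map]
  rw [(hf.map φ).discr_eq, hf.discr_eq, derivative_map, h, hf.natDegree_map]
  simp

theorem Monic.discr_mul {f g : R[X]} (hf : f.Monic) (hg : g.Monic) :
    (f * g).discr = f.discr * g.discr * resultant f g ^ 2 := by
  have hexp (m n : ℕ) : (m + n) * (m + n - 1) / 2 = m * (m - 1) / 2 + n * (n - 1) / 2 + m * n := by
    simp only [← Nat.choose_two_right, Nat.add_choose_eq, Finset.Nat.antidiagonal_succ]
    simp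
    ring
  have h₁ : resultant f (derivative (f * g)) = resultant f (derivative f) * resultant f g := by
    rw [derivative_mul, hf.resultant_add_mul_right, hf.resultant_mul_right]
  have h₂ : resultant g (derivative (f * g)) =
      (-1) ^ (f.natDegree * g.natDegree) * resultant f g * resultant g (derivative g) := by
    rw [derivative_mul, add_comm, mul_comm (derivative f), hg.resultant_add_mul_right,
      hg.resultant_mul_right, resultant_comm g f, mul_comm g.natDegree]
  have hsq (k : ℕ) : ((-1 : R) ^ k) ^ 2 = 1 := by rw [← pow_mul, mul_comm, pow_mul]; simp
  rw [(hf.mul hg).discr_eq, hf.discr_eq, hg.discr_eq, hf.resultant_mul_left hg, h₁, h₂,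
    hf.natDegree_mul hg, hexp, pow_add, pow_add]
  linear_combination ((-1) ^ (f.natDegree * (f.natDegree - 1) / 2) *
    (-1) ^ (g.natDegree * (g.natDegree - 1) / 2) * resultant f (derivative f) *
    resultant g (derivative g) * resultant f g ^ 2) * hsq (f.natDegree * g.natDegree)

theorem discr_prod_X_sub_C {n : ℕ} (a : Fin n → R) :
    (∏ i, (X - C (a i))).discr = (Matrix.vandermonde a).det ^ 2 := by
  nontriviality R
  induction n with
  | zero => simpa using discr_C (1 : R)
  | succ n ih =>
    have hm : (∏ i : Fin n, (X - C (a i.succ))).Monic :=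
      monic_prod_of_monic _ _ fun i _ ↦ monic_X_sub_C _
    have hres : resultant (X - C (a 0)) (∏ i : Fin n, (X - C (a i.succ))) =
        ∏ i : Fin n, (a 0 - a i.succ) := by
      rw [natDegree_X_sub_C, resultant_X_sub_C_left _ _ _ le_rfl, eval_prod]
      simp
    rw [Fin.prod_univ_succ, (monic_X_sub_C _).discr_mul hm, ih fun i ↦ a i.succ, hres,
      discr_of_degree_eq_one (degree_X_sub_C _), Matrix.det_vandermonde, Matrix.det_vandermonde,
      Fin.prod_univ_succ, Fin.prod_Ioi_zero, one_mul, mul_comm, mul_pow]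
    simp only [Fin.prod_Ioi_succ, ← Finset.prod_pow]
    congr 1
    exact Finset.prod_congr rfl fun i _ ↦ by ring

end CommRing

section FiniteField

variable {F : Type*} [Field F] [Fintype F]

open FiniteField in
/-- An irreducible polynomial over a finite field splits in its root field, the roots being the
Frobenius conjugates of one root. -/
theorem map_eq_prod_X_sub_C_frobenius {p : F[X]} (hp : p.Monic) [hirr : Fact (Irreducible p)]
    (a : Fin p.natDegree → AdjoinRoot p)
    (ha : ∀ i, a i = AdjoinRoot.root p ^ Fintype.card F ^ (i : ℕ)) :
    Function.Injective a ∧ p.map (algebraMap F (AdjoinRoot p)) = ∏ i, (X - C (a i)) := by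
  have : Module.Finite F (AdjoinRoot p) := hp.finite_adjoinRoot
  have : Finite (AdjoinRoot p) := Module.finite_of_finite F
  have hdim : Module.finrank F (AdjoinRoot p) = p.natDegree := by
    rw [(AdjoinRoot.powerBasis hp.ne_zero).finrank, AdjoinRoot.powerBasis_dim]
  have ha' (i) : a i = (frobeniusAlgHom F (AdjoinRoot p) ^ (i : ℕ)) (AdjoinRoot.root p) := by
    rw [ha, AlgHom.coe_pow, coe_frobeniusAlgHom, pow_iterate]
  have hinj : Function.Injective a := fun i j hij ↦ by
    rw [ha', ha'] at hij
    have := @(bijective_frobeniusAlgHom_pow F (AdjoinRoot p)).1 (finCongr hdim.symm i)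
      (finCongr hdim.symm j) (AdjoinRoot.algHom_ext hij)
    simpa using this
  refine ⟨hinj, eq_of_monic_of_dvd_of_natDegree_le
    (monic_prod_of_monic _ _ fun i _ ↦ monic_X_sub_C _) (hp.map _) ?_ ?_⟩
  · refine Finset.prod_dvd_of_coprime (fun i _ j _ hij ↦ pairwise_coprime_X_sub_C hinj hij)
      fun i _ ↦ ?_
    rw [dvd_iff_isRoot, IsRoot, eval_map_algebraMap, ha', aeval_algHom_apply]
    simp
  · rw [natDegree_prod_of_monic _ _ fun i _ ↦ monic_X_sub_C _]
    simp [hp.natDegree_map]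

open FiniteField in
/-- Stickelberger's theorem for an irreducible polynomial. -/
theorem quadraticChar_discr_of_irreducible [DecidableEq F] (hF : ringChar F ≠ 2) {p : F[X]}
    (hp : p.Monic) (hirr : Irreducible p) :
    quadraticChar F p.discr = (-1) ^ (p.natDegree - 1) := by
  have := Fact.mk hirr
  have : Module.Finite F (AdjoinRoot p) := hp.finite_adjoinRoot
  have : Finite (AdjoinRoot p) := Module.finite_of_finite F
  have := Fintype.ofFinite (AdjoinRoot p)
  have hdim : Module.finrank F (AdjoinRoot p) = p.natDegree := by
    rw [(AdjoinRoot.powerBasis hp.ne_zero).finrank, AdjoinRoot.powerBasis_dim]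
  set a : Fin p.natDegree → AdjoinRoot p :=
    fun i ↦ AdjoinRoot.root p ^ Fintype.card F ^ (i : ℕ) with ha
  obtain ⟨hinj, hprod⟩ := map_eq_prod_X_sub_C_frobenius hp a fun _ ↦ rfl
  have hδ : (Matrix.vandermonde a).det ≠ 0 := Matrix.det_vandermonde_ne_zero_iff.mpr hinj
  have hdisc : algebraMap F (AdjoinRoot p) p.discr = (Matrix.vandermonde a).det ^ 2 := by
    rw [← hp.discr_map, hprod, discr_prod_X_sub_C]
  have hrot (i) : a i ^ Fintype.card F = a (finRotate _ i) := by
    obtain ⟨d, hd⟩ : ∃ d, p.natDegree = d + 1 :=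
      Nat.exists_eq_succ_of_ne_zero hirr.natDegree_pos.ne'
    simp only [ha, ← pow_mul, ← pow_succ]
    have hcard : AdjoinRoot.root p ^ Fintype.card F ^ p.natDegree = AdjoinRoot.root p := by
      rw [← hdim, ← Module.card_eq_pow_finrank, pow_card]
    clear_value a
    generalize p.natDegree = e at *
    subst hd
    rcases Fin.eq_castSucc_or_eq_last i with ⟨j, rfl⟩ | rfl
    · simp
    · simpa using hcard
  have hfrob : (Matrix.vandermonde a).det ^ Fintype.card F =
      (-1) ^ (p.natDegree - 1) * (Matrix.vandermonde a).det := by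
    have h₁ : (frobeniusAlgHom F (AdjoinRoot p)).mapMatrix (Matrix.vandermonde a) =
        (Matrix.vandermonde a).submatrix (finRotate _) id := by
      ext i j
      rw [AlgHom.mapMatrix_apply, Matrix.map_apply, Matrix.submatrix_apply,
        Matrix.vandermonde_apply, Matrix.vandermonde_apply, ← hrot]
      exact pow_right_comm (a i) j _
    have h₂ := AlgHom.map_det (frobeniusAlgHom F (AdjoinRoot p)) (Matrix.vandermonde a)
    rw [h₁, Matrix.det_permute, sign_finRotate] at h₂
    simpa using h₂
  have hchar : algebraMap F (AdjoinRoot p) (quadraticChar F p.discr : F) =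
      (-1) ^ (p.natDegree - 1) := by
    refine mul_right_cancel₀ hδ ?_
    rw [← hfrob, quadraticChar_eq_pow_of_char_ne_two' hF, map_pow, hdisc, ← pow_mul, ← pow_succ,
      Nat.two_mul_div_two_add_one_of_odd (Nat.odd_iff.mpr (odd_card_of_char_ne_two hF))]
  have hchar' : ((quadraticChar F p.discr : ℤ) : F) = (-1) ^ (p.natDegree - 1) :=
    (algebraMap F (AdjoinRoot p)).injective (by simpa using hchar)
  have hne : p.discr ≠ 0 := fun h ↦ hδ (by simpa [h] using hdisc.symm)
  have hsign := Ring.neg_one_ne_one_of_char_ne_two hF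
  rcases quadraticChar_dichotomy hne with h | h <;>
    rcases neg_one_pow_eq_or ℤ (p.natDegree - 1) with h' | h' <;>
    rw [h, h'] <;> exfalso <;> refine hsign ?_ <;>
    have h'' := congrArg (Int.cast : ℤ → F) h' <;> push_cast at h'' <;>
    rw [h, h''] at hchar' <;> push_cast at hchar' <;> first | exact hchar' | exact hchar'.symm

end FiniteField

section MonicSums

variable {F : Type*} [Field F] [Fintype F] [DecidableEq F]

/-- By Stickelberger's theorem this is the Möbius function of `F[X]`, expressed through the
quadratic character of the discriminant. -/
noncomputable def discrMoebius (f : F[X]) : ℤ :=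
  (-1) ^ f.natDegree * quadraticChar F f.discr

theorem discrMoebius_irreducible_mul (hF : ringChar F ≠ 2) {p f : F[X]} (hp : p.Monic)
    (hirr : Irreducible p) (hf : f.Monic) (hpf : ¬ p ∣ f) :
    discrMoebius (p * f) = -discrMoebius f := by
  have hres : resultant p f ≠ 0 :=
    resultant_ne_zero p f (hirr.coprime_iff_not_dvd.mpr hpf)
  have hsign : (-1 : ℤ) ^ p.natDegree * (-1) ^ (p.natDegree - 1) = -1 := by
    rw [← pow_add, Odd.neg_one_pow]
    have := hirr.natDegree_pos
    exact ⟨p.natDegree - 1, by lia⟩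
  rw [discrMoebius, discrMoebius, hp.discr_mul hf, hp.natDegree_mul hf, map_mul, map_mul, map_pow,
    quadraticChar_sq_one hres, quadraticChar_discr_of_irreducible hF hp hirr, pow_add]
  linear_combination (-1) ^ f.natDegree * quadraticChar F f.discr * hsign

theorem discrMoebius_eq_zero_of_sq_dvd {p f : F[X]} (hp : p.Monic)
    (hirr : Irreducible p) (hf : f.Monic) (hpf : p * p ∣ f) :
    discrMoebius f = 0 := by
  obtain ⟨g, rfl⟩ := hpf
  have hg : (p * g).Monic := hp.of_mul_monic_left (by rwa [← mul_assoc])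
  have hres : resultant p (p * g) = 0 := by
    rw [hp.resultant_mul_right, resultant_self_eq_zero _ hirr.natDegree_pos.ne', zero_mul]
  rw [discrMoebius, mul_assoc, hp.discr_mul hg, hres]
  simp

end MonicSums

section Counting

variable {F : Type*} [Field F]

theorem monicOf_eq (n : ℕ) (t : Fin n → F) :
    monicOf n t = X ^ n + ∑ i : Fin n, C (t i.rev) * X ^ (i : ℕ) := by
  rw [monicOf, ← Equiv.sum_comp Fin.revPerm]
  refine congrArg _ (Finset.sum_congr rfl fun i _ ↦ ?_)
  rw [Fin.revPerm_apply, Fin.val_rev]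
  congr 2
  lia

theorem degree_sum_C_mul_X_pow_lt (n : ℕ) (t : Fin n → F) :
    (∑ i : Fin n, C (t i) * X ^ (i : ℕ)).degree < (n : WithBot ℕ) := by
  refine (degree_sum_le _ _).trans_lt ((Finset.sup_lt_iff (WithBot.bot_lt_coe n)).mpr fun i _ ↦ ?_)
  exact (degree_C_mul_X_pow_le _ _).trans_lt (WithBot.coe_lt_coe.mpr i.2)

theorem monicOf_monic (n : ℕ) (t : Fin n → F) : (monicOf n t).Monic := by
  rw [monicOf_eq]
  exact monic_X_pow_add (degree_sum_C_mul_X_pow_lt n _)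

theorem natDegree_monicOf (n : ℕ) (t : Fin n → F) : (monicOf n t).natDegree = n := by
  rw [monicOf_eq, natDegree_add_eq_left_of_degree_lt, natDegree_X_pow]
  simpa using degree_sum_C_mul_X_pow_lt n fun i ↦ t i.rev

theorem monicOf_injective (n : ℕ) : Function.Injective (monicOf (F := F) n) := fun t u h ↦ by
  rw [monicOf_eq, monicOf_eq, add_right_inj] at h
  have hrev (i : Fin n) : t i.rev = u i.rev := by
    have := congrArg (coeff · (i : ℕ)) h
    simpa [finsetSum_coeff, coeff_C_mul, coeff_X_pow, Fin.val_inj] using this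
  funext i
  simpa using hrev i.rev

theorem exists_monicOf_eq {f : F[X]} (hf : f.Monic) : ∃ t, monicOf f.natDegree t = f := by
  refine ⟨fun i ↦ f.coeff i.rev, ?_⟩
  conv_rhs => rw [hf.as_sum]
  rw [monicOf_eq, ← Fin.sum_univ_eq_sum_range fun i ↦ C (f.coeff i) * X ^ i]
  simp

variable [Fintype F]

open Classical in
/-- The monic polynomials of degree `n`. -/
noncomputable def monics (F : Type*) [Field F] [Fintype F] (n : ℕ) : Finset F[X] :=
  Finset.univ.image (monicOf (F := F) n)

theorem mem_monics {n : ℕ} {f : F[X]} : f ∈ monics F n ↔ f.Monic ∧ f.natDegree = n := by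
  simp only [monics, Finset.mem_image, Finset.mem_univ, true_and]
  constructor
  · rintro ⟨t, rfl⟩
    exact ⟨monicOf_monic n t, natDegree_monicOf n t⟩
  · rintro ⟨hf, rfl⟩
    exact exists_monicOf_eq hf

theorem card_monics (n : ℕ) : (monics F n).card = Fintype.card F ^ n := by
  classical
  rw [monics, Finset.card_image_of_injective _ (monicOf_injective n)]
  simp

theorem sum_monics {M : Type*} [AddCommMonoid M] (n : ℕ) (φ : F[X] → M) :
    ∑ f ∈ monics F n, φ f = ∑ t, φ (monicOf n t) := by
  classical
  rw [monics, Finset.sum_image (monicOf_injective n).injOn]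

open Classical in
/-- The pairs of monic polynomials whose product has degree `n`. -/
noncomputable def monicPairs (F : Type*) [Field F] [Fintype F] (n : ℕ) : Finset (F[X] × F[X]) :=
  (Finset.HasAntidiagonal.antidiagonal n).biUnion fun k ↦ monics F k.1 ×ˢ monics F k.2

theorem mem_monicPairs {n : ℕ} {x : F[X] × F[X]} :
    x ∈ monicPairs F n ↔ x.1.Monic ∧ x.2.Monic ∧ x.1.natDegree + x.2.natDegree = n := by
  simp only [monicPairs, Finset.mem_biUnion, Finset.HasAntidiagonal.mem_antidiagonal,
    Finset.mem_product, mem_monics]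
  constructor
  · rintro ⟨k, hk, ⟨h₁, h₂⟩, h₃, h₄⟩
    exact ⟨h₁, h₃, by rw [h₂, h₄, hk]⟩
  · exact fun ⟨h₁, h₂, h⟩ ↦ ⟨(_, _), h, ⟨h₁, rfl⟩, h₂, rfl⟩

theorem sum_monicPairs_fst (n : ℕ) (φ : F[X] → ℤ) :
    ∑ x ∈ monicPairs F n, φ x.1 =
      ∑ k ∈ Finset.range (n + 1), (∑ f ∈ monics F k, φ f) * Fintype.card F ^ (n - k) := by
  classical
  rw [monicPairs, Finset.sum_biUnion]
  · rw [Finset.Nat.sum_antidiagonal_eq_sum_range_succ_mk]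
    refine Finset.sum_congr rfl fun k _ ↦ ?_
    rw [Finset.sum_product, Finset.sum_mul]
    simp [card_monics, mul_comm]
  · intro k _ l _ hkl
    refine Finset.disjoint_left.mpr fun x hx hx' ↦ hkl ?_
    simp only [Finset.mem_product, mem_monics] at hx hx'
    grind

variable [DecidableEq F]

open Classical in
theorem sum_discrMoebius_divisors (hF : ringChar F ≠ 2) {n : ℕ} (hn : n ≠ 0) {f : F[X]}
    (hf : f ∈ monics F n) :
    ∑ x ∈ monicPairs F n with x.1 * x.2 = f, discrMoebius x.1 = 0 := by
  obtain ⟨hfm, hfd⟩ := mem_monics.mp hf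
  obtain ⟨p, hp, hirr, hpf⟩ := exists_monic_irreducible_factor f
    (not_isUnit_of_natDegree_pos f (by lia))
  have hp0 := hp.ne_zero
  rw [← Finset.sum_filter_of_ne (p := fun x ↦ ¬ p * p ∣ x.1)]
  swap
  · intro x hx hne hdvd
    exact hne (discrMoebius_eq_zero_of_sq_dvd hp hirr
      (mem_monicPairs.mp (Finset.mem_filter.mp hx).1).1 hdvd)
  have hmem (x : F[X] × F[X]) :
      x ∈ {x ∈ {x ∈ monicPairs F n | x.1 * x.2 = f} | ¬ p * p ∣ x.1} ↔
        x.1.Monic ∧ x.2.Monic ∧ x.1 * x.2 = f ∧ ¬ p * p ∣ x.1 := by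
    simp only [Finset.mem_filter, mem_monicPairs]
    constructor
    · tauto
    · rintro ⟨h₁, h₂, h₃, h₄⟩
      exact ⟨⟨⟨h₁, h₂, by rw [← h₁.natDegree_mul h₂, h₃, hfd]⟩, h₃⟩, h₄⟩
  have hcases (x) (hx : x ∈ {x ∈ {x ∈ monicPairs F n | x.1 * x.2 = f} | ¬ p * p ∣ x.1}) :
      (∃ a b : F[X], a.Monic ∧ b.Monic ∧ ¬ p ∣ a ∧ a * (p * b) = f ∧ x = (p * a, b)) ∨
      (∃ a b : F[X], a.Monic ∧ b.Monic ∧ ¬ p ∣ a ∧ a * (p * b) = f ∧ x = (a, p * b)) := by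
    obtain ⟨a, b⟩ := x
    obtain ⟨h₁, h₂, h₃, h₄⟩ := (hmem _).mp hx
    dsimp only at h₁ h₂ h₃ h₄
    by_cases hpa : p ∣ a
    · obtain ⟨a, rfl⟩ := hpa
      refine .inl ⟨a, b, hp.of_mul_monic_left h₁, h₂, fun h ↦ h₄ (mul_dvd_mul_left p h), ?_, rfl⟩
      rw [← h₃]; ring
    · obtain ⟨b, rfl⟩ := (hirr.prime.dvd_or_dvd (h₃ ▸ hpf)).resolve_left hpa
      exact .inr ⟨a, b, h₁, hp.of_mul_monic_left h₂, hpa, h₃, rfl⟩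
  refine Finset.sum_involution
    (fun x _ ↦ if p ∣ x.1 then (x.1 / p, p * x.2) else (p * x.1, x.2 / p)) ?_ ?_ ?_ ?_
  · intro x hx
    rcases hcases x hx with ⟨a, b, ha, hb, hpa, hab, rfl⟩ | ⟨a, b, ha, hb, hpa, hab, rfl⟩ <;>
      simp [hpa, hp0, discrMoebius_irreducible_mul hF hp hirr ha hpa]
  · intro x hx _ heq
    rcases hcases x hx with ⟨a, b, ha, hb, hpa, hab, rfl⟩ | ⟨a, b, ha, hb, hpa, hab, rfl⟩
    · simp only [dvd_mul_right, if_true, mul_div_cancel_left₀ _ hp0, Prod.mk.injEq] at heq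
      exact hpa (heq.1 ▸ dvd_mul_right p a)
    · simp only [hpa, if_false, Prod.mk.injEq] at heq
      exact hpa (heq.1 ▸ dvd_mul_right p a)
  · intro x hx
    rw [hmem]
    rcases hcases x hx with ⟨a, b, ha, hb, hpa, hab, rfl⟩ | ⟨a, b, ha, hb, hpa, hab, rfl⟩
    · simp only [dvd_mul_right, if_true, mul_div_cancel_left₀ _ hp0]
      exact ⟨ha, hp.mul hb, hab, fun h ↦ hpa ((dvd_mul_right p p).trans h)⟩
    · simp only [hpa, if_false, mul_div_cancel_left₀ _ hp0]
      exact ⟨hp.mul ha, hb, by rw [← hab]; ring, fun h ↦ hpa ((mul_dvd_mul_iff_left hp0).mp h)⟩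
  · intro x hx
    rcases hcases x hx with ⟨a, b, ha, hb, hpa, hab, rfl⟩ | ⟨a, b, ha, hb, hpa, hab, rfl⟩ <;>
      simp [hpa, hp0]

theorem sum_discrMoebius_mul_card_pow (hF : ringChar F ≠ 2) {n : ℕ} (hn : n ≠ 0) :
    ∑ k ∈ Finset.range (n + 1),
      (∑ f ∈ monics F k, discrMoebius f) * (Fintype.card F : ℤ) ^ (n - k) = 0 := by
  classical
  rw [← sum_monicPairs_fst, ← Finset.sum_fiberwise_of_maps_to (t := monics F n)
    (g := fun x ↦ x.1 * x.2)]
  · exact Finset.sum_eq_zero fun f hf ↦ sum_discrMoebius_divisors hF hn hf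
  · intro x hx
    obtain ⟨h₁, h₂, h₃⟩ := mem_monicPairs.mp hx
    exact mem_monics.mpr ⟨h₁.mul h₂, by rw [h₁.natDegree_mul h₂, h₃]⟩

theorem sum_discrMoebius_eq_zero (hF : ringChar F ≠ 2) {n : ℕ} (hn : 2 ≤ n) :
    ∑ f ∈ monics F n, discrMoebius f = 0 := by
  obtain ⟨m, rfl⟩ : ∃ m, n = m + 1 := ⟨n - 1, by lia⟩
  have h := sum_discrMoebius_mul_card_pow (F := F) hF (Nat.succ_ne_zero m)
  have h' := sum_discrMoebius_mul_card_pow (F := F) hF (show m ≠ 0 by lia)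
  rw [Finset.sum_range_succ, Nat.sub_self, pow_zero, mul_one] at h
  have hstep : ∑ k ∈ Finset.range (m + 1), (∑ f ∈ monics F k, discrMoebius f) *
      (Fintype.card F : ℤ) ^ (m + 1 - k) = 0 := by
    rw [← zero_mul (Fintype.card F : ℤ), ← h', Finset.sum_mul]
    refine Finset.sum_congr rfl fun k hk ↦ ?_
    rw [Nat.sub_add_comm (Finset.mem_range_succ_iff.mp hk), pow_succ, mul_assoc]
  rwa [Nat.succ_eq_add_one, hstep, zero_add] at h

/-- The quadratic characters of the discriminants of monic polynomials of degree `n ≥ 2` sum to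
zero. -/
theorem sum_quadraticChar_discr_eq_zero (hF : ringChar F ≠ 2) {n : ℕ} (hn : 2 ≤ n) :
    ∑ t : Fin n → F, quadraticChar F (monicOf n t).discr = 0 := by
  have h := sum_discrMoebius_eq_zero (F := F) hF hn
  rw [sum_monics] at h
  simp only [discrMoebius, natDegree_monicOf, ← Finset.mul_sum] at h
  exact (mul_eq_zero.mp h).resolve_left (by simp)

end Counting

end Polynomial

theorem discOf_eq_algebraMap_discr {F : Type*} [Field F] (n : ℕ) (t : Fin n → F) :
    discOf n t = algebraMap F (AlgebraicClosure F) (monicOf n t).discr := by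
  have hm := (monicOf_monic n t).map (algebraMap F (AlgebraicClosure F))
  rw [← (monicOf_monic n t).discr_map, hm.discr_eq,
    resultant_eq_prod_eval _ _ _ le_rfl (IsAlgClosed.splits _), hm.leadingCoeff, one_pow, one_mul,
    (monicOf_monic n t).natDegree_map, natDegree_monicOf, discOf]

/-- For an odd prime power `q` and `n ≥ 2`, the number of tuples `(t_1,…,t_n) ∈ F_q^n`
whose discriminant is a nonzero quadratic residue equals the number of tuples whose
discriminant is a (nonzero) quadratic non-residue. -/
theorem stmt_17 {F : Type*} [Field F] [Fintype F] (q n : ℕ) (hq : Fintype.card F = q)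
    (hodd : Odd q) (hn : 2 ≤ n) :
    Nat.card {t : Fin n → F // ∃ a : F,
        algebraMap F (AlgebraicClosure F) a = discOf n t ∧ a ≠ 0 ∧ IsSquare a} =
      Nat.card {t : Fin n → F // ∃ a : F,
        algebraMap F (AlgebraicClosure F) a = discOf n t ∧ a ≠ 0 ∧ ¬ IsSquare a} := by
  classical
  subst hq
  have hF : ringChar F ≠ 2 := fun h ↦ by
    have := FiniteField.even_card_of_char_two h
    rw [Nat.odd_iff] at hodd
    lia
  have hsq (t : Fin n → F) : (∃ a : F, algebraMap F (AlgebraicClosure F) a = discOf n t ∧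
      a ≠ 0 ∧ IsSquare a) ↔ quadraticChar F (monicOf n t).discr = 1 := by
    simp only [discOf_eq_algebraMap_discr, (algebraMap F (AlgebraicClosure F)).injective.eq_iff,
      exists_eq_left]
    constructor
    · exact fun ⟨h, h'⟩ ↦ (quadraticChar_one_iff_isSquare h).mpr h'
    · intro h
      have h0 : (monicOf n t).discr ≠ 0 := fun h0 ↦ by simp [h0] at h
      exact ⟨h0, (quadraticChar_one_iff_isSquare h0).mp h⟩
  have hnsq (t : Fin n → F) : (∃ a : F, algebraMap F (AlgebraicClosure F) a = discOf n t ∧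
      a ≠ 0 ∧ ¬ IsSquare a) ↔ quadraticChar F (monicOf n t).discr = -1 := by
    simp only [discOf_eq_algebraMap_discr, (algebraMap F (AlgebraicClosure F)).injective.eq_iff,
      exists_eq_left, quadraticChar_neg_one_iff_not_isSquare, and_iff_right_iff_imp]
    exact fun h h0 ↦ h (h0 ▸ IsSquare.zero)
  simp only [hsq, hnsq, Nat.card_eq_fintype_card, Fintype.card_subtype]
  have hsum := sum_quadraticChar_discr_eq_zero (F := F) hF hn
  have hchar (a : F) : quadraticChar F a =
      (if quadraticChar F a = 1 then 1 else 0) - (if quadraticChar F a = -1 then 1 else 0) := by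
    rcases eq_or_ne a 0 with rfl | ha
    · simp
    · rcases quadraticChar_dichotomy ha with h | h <;> simp [h]
  rw [Finset.sum_congr rfl fun t _ ↦ hchar (monicOf n t).discr, Finset.sum_sub_distrib,
    Finset.sum_boole, Finset.sum_boole, sub_eq_zero] at hsum
  exact_mod_cast hsum
end
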